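/- arXiv:1511.02733 — 2 statements merged into one kernel-verified Lean document; each statement's English description precedes it below -/
import Mathlib

section
/- Push-forward of a Hamiltonian-dissipative vector field with translation by a symplectic transformation (Lemma 5.3). Let η ∈ ℝ, ξ, ζ ∈ ℝⁿ, let φ : ℝⁿ → ℝⁿ be a C² diffeomorphism, S : ℝⁿ → ℝ of class C², and H : ℝⁿ×ℝⁿ → ℝ of class C². Define g(θ,r) = (φ(θ), (Dφ(θ)ᵀ)⁻¹·(r + ∇S(θ) + ξ)) and the vector field v(θ,r) = (∇_r H(θ,r), −∇_θ H(θ,r) − η(r − ζ)). Then the push-forward g_*v := (Dg · v)∘g⁻¹ is given, at every point (Θ,R), by g_*v(Θ,R) = (∇_R Ĥ(Θ,R), −∇_Θ Ĥ(Θ,R) − η(R − ζ̂)), where ζ̂ = ζ + ξ and Ĥ(Θ,R) = H(g⁻¹(Θ,R)) − η·(S(φ⁻¹(Θ)) + ζ̂·(φ⁻¹(Θ) − Θ)). -/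
open scoped RealInnerProductSpace

open InnerProductSpace ContinuousLinearMap

section Gradient

variable {E F : Type*} [NormedAddCommGroup E] [InnerProductSpace ℝ E]
  [NormedAddCommGroup F] [InnerProductSpace ℝ F]

theorem inner_gradient_eq_fderiv [CompleteSpace E] (f : E → ℝ) (x u : E) :
    ⟪gradient f x, u⟫ = fderiv ℝ f x u := by
  rw [gradient, toDual_symm_apply]

theorem inner_gradient_prodMk_right [CompleteSpace F] {f : E × F → ℝ} {f' : E × F →L[ℝ] ℝ} {p : E × F}
    (hf : HasFDerivAt f f' p) (k : F) :
    ⟪gradient (fun r => f (p.1, r)) p.2, k⟫ = f' (0, k) := by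
  have h : HasFDerivAt (fun r => f (p.1, r)) (f'.comp (ContinuousLinearMap.inr ℝ E F)) p.2 :=
    HasFDerivAt.comp p.2 (g := f) hf (hasFDerivAt_prodMk_right p.1 p.2)
  rw [inner_gradient_eq_fderiv, h.fderiv]
  simp

theorem inner_gradient_prodMk_left [CompleteSpace E] {f : E × F → ℝ} {f' : E × F →L[ℝ] ℝ} {p : E × F}
    (hf : HasFDerivAt f f' p) (k : E) :
    ⟪gradient (fun θ => f (θ, p.2)) p.1, k⟫ = f' (k, 0) := by
  have h : HasFDerivAt (fun θ => f (θ, p.2)) (f'.comp (ContinuousLinearMap.inl ℝ E F)) p.1 :=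
    HasFDerivAt.comp p.1 (g := f) hf (hasFDerivAt_prodMk_left p.1 p.2)
  rw [inner_gradient_eq_fderiv, h.fderiv]
  simp

/-- The inverse of the Riesz isomorphism of a real Hilbert space, as an `ℝ`-linear map. -/
noncomputable def rieszSymm (E : Type*) [NormedAddCommGroup E] [InnerProductSpace ℝ E]
    [CompleteSpace E] : (E →L[ℝ] ℝ) →L[ℝ] E where
  toFun := (toDual ℝ E).symm
  map_add' := map_add _
  map_smul' c x := by simp
  cont := (toDual ℝ E).symm.continuous

theorem inner_rieszSymm [CompleteSpace E] (l : E →L[ℝ] ℝ) (u : E) : ⟪rieszSymm E l, u⟫ = l u :=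
  toDual_symm_apply

theorem HasFDerivAt.gradient [CompleteSpace E] {f : E → ℝ} {x : E}
    {f'' : E →L[ℝ] E →L[ℝ] ℝ}
    (hf : HasFDerivAt (fderiv ℝ f) f'' x) :
    HasFDerivAt (_root_.gradient f) ((rieszSymm E).comp f'') x :=
  (rieszSymm E).hasFDerivAt.comp x hf

end Gradient

section Diffeomorphism

variable {E : Type*} [NormedAddCommGroup E] [InnerProductSpace ℝ E]

theorem fderiv_comp_fderiv_of_leftInverse {φ ψ : E → E} (hφ : Differentiable ℝ φ)
    (hψ : Differentiable ℝ ψ) (h : Function.LeftInverse ψ φ) (x : E) :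
    (fderiv ℝ ψ (φ x)).comp (fderiv ℝ φ x) = ContinuousLinearMap.id ℝ E := by
  rw [← fderiv_comp x (hψ _) (hφ _), h.id, fderiv_id]

theorem eq_adjoint_fderiv_inverse [CompleteSpace E] {φ ψ : E → E} (hφ : Differentiable ℝ φ)
    (hψ : Differentiable ℝ ψ) (h : Function.LeftInverse ψ φ) {x : E} {A : E →L[ℝ] E}
    (hA : A.comp (adjoint (fderiv ℝ φ x)) = ContinuousLinearMap.id ℝ E) :
    A = star (fderiv ℝ ψ (φ x)) := by
  have h1 : (adjoint (fderiv ℝ φ x)).comp (star (fderiv ℝ ψ (φ x))) =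
      ContinuousLinearMap.id ℝ E := by
    rw [star_eq_adjoint, ← adjoint_comp, fderiv_comp_fderiv_of_leftInverse hφ hψ h,
      adjoint_id]
  calc A = A.comp ((adjoint (fderiv ℝ φ x)).comp (star (fderiv ℝ ψ (φ x)))) := by
        rw [h1, comp_id]
    _ = star (fderiv ℝ ψ (φ x)) := by rw [← comp_assoc, hA, id_comp]

theorem ContDiff.hasFDerivAt_fderiv {F : Type*} [NormedAddCommGroup F] [NormedSpace ℝ F]
    {f : E → F} (hf : ContDiff ℝ 2 f) (x : E) :
    HasFDerivAt (fderiv ℝ f) (fderiv ℝ (fderiv ℝ f) x) x :=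
  ((hf.fderiv_right (m := 1) (by norm_num)).differentiable (by norm_num) x).hasFDerivAt

theorem ContDiff.fderiv_fderiv_comm {F : Type*} [NormedAddCommGroup F] [NormedSpace ℝ F]
    {f : E → F} (hf : ContDiff ℝ 2 f) (x u w : E) :
    fderiv ℝ (fderiv ℝ f) x u w = fderiv ℝ (fderiv ℝ f) x w u :=
  hf.contDiffAt.isSymmSndFDerivAt (by simp) u w

end Diffeomorphism

/-- **Lemma 5.3** (push-forward of a Hamiltonian-dissipative vector field with
translation by a symplectic transformation).  With
`g(θ,r) = (φ(θ), (Dφ(θ)ᵀ)⁻¹(r + ∇S(θ) + ξ))` and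
`v(θ,r) = (∇_r H, −∇_θ H − η(r − ζ))`, the push-forward `g_*v = (Dg·v)∘g⁻¹` equals
`(∇_R Ĥ, −∇_Θ Ĥ − η(R − ζ̂))` with `ζ̂ = ζ + ξ` and
`Ĥ(Θ,R) = H(g⁻¹(Θ,R)) − η (S(φ⁻¹(Θ)) + ζ̂·(φ⁻¹(Θ) − Θ))`.  Here `A θ` is the inverse
of the transposed Jacobian `Dφ(θ)ᵀ` (the adjoint of `fderiv ℝ φ θ`), `ψ = φ⁻¹`, and
`Ginv = g⁻¹`. -/
theorem pushforward_hamiltonian_dissipative_translated (n : ℕ) (η : ℝ)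
    (ξ ζ : EuclideanSpace ℝ (Fin n))
    (φv ψv : EuclideanSpace ℝ (Fin n) → EuclideanSpace ℝ (Fin n))
    (hφ : ContDiff ℝ 2 φv) (hψ : ContDiff ℝ 2 ψv)
    (hlr : Function.LeftInverse ψv φv) (hrl : Function.RightInverse ψv φv)
    (S : EuclideanSpace ℝ (Fin n) → ℝ) (hS : ContDiff ℝ 2 S)
    (H : EuclideanSpace ℝ (Fin n) × EuclideanSpace ℝ (Fin n) → ℝ) (hH : ContDiff ℝ 2 H)
    (A : EuclideanSpace ℝ (Fin n) → EuclideanSpace ℝ (Fin n) →L[ℝ] EuclideanSpace ℝ (Fin n))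
    (hA₁ : ∀ θ, (A θ).comp (ContinuousLinearMap.adjoint (fderiv ℝ φv θ)) =
      ContinuousLinearMap.id ℝ (EuclideanSpace ℝ (Fin n)))
    (hA₂ : ∀ θ, (ContinuousLinearMap.adjoint (fderiv ℝ φv θ)).comp (A θ) =
      ContinuousLinearMap.id ℝ (EuclideanSpace ℝ (Fin n)))
    (G Ginv V : EuclideanSpace ℝ (Fin n) × EuclideanSpace ℝ (Fin n) →
      EuclideanSpace ℝ (Fin n) × EuclideanSpace ℝ (Fin n))
    (hG : G = fun p => (φv p.1, A p.1 (p.2 + gradient S p.1 + ξ)))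
    (hGinv : Ginv = fun p =>
      (ψv p.1, ContinuousLinearMap.adjoint (fderiv ℝ φv (ψv p.1)) p.2
        - gradient S (ψv p.1) - ξ))
    (hV : V = fun p => (gradient (fun r => H (p.1, r)) p.2,
      -gradient (fun θ => H (θ, p.2)) p.1 - η • (p.2 - ζ)))
    (Hhat : EuclideanSpace ℝ (Fin n) × EuclideanSpace ℝ (Fin n) → ℝ)
    (hHhat : Hhat = fun p =>
      H (Ginv p) - η * (S (ψv p.1) + ⟪ζ + ξ, ψv p.1 - p.1⟫)) :
    ∀ p : EuclideanSpace ℝ (Fin n) × EuclideanSpace ℝ (Fin n),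
      fderiv ℝ G (Ginv p) (V (Ginv p)) =
        (gradient (fun R => Hhat (p.1, R)) p.2,
          -gradient (fun Θ => Hhat (Θ, p.2)) p.1 - η • (p.2 - (ζ + ξ))) := by
  intro p
  have hφd : Differentiable ℝ φv := hφ.differentiable (by norm_num)
  have hψd : Differentiable ℝ ψv := hψ.differentiable (by norm_num)
  have hSd : Differentiable ℝ S := hS.differentiable (by norm_num)
  have hHd : Differentiable ℝ H := hH.differentiable (by norm_num)
  obtain ⟨Θ, R⟩ := p
  set θ := ψv Θ with hθ
  have hφθ : φv θ = Θ := hrl Θ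
  have hψφ : ∀ u, fderiv ℝ ψv Θ (fderiv ℝ φv θ u) = u := fun u => by
    have := fderiv_comp_fderiv_of_leftInverse hφd hψd hlr θ
    rw [hφθ] at this
    exact DFunLike.congr_fun this u
  set q := Ginv (Θ, R) with hq
  have hq_eq : q = (θ, adjoint (fderiv ℝ φv θ) R - gradient S θ - ξ) := by rw [hq, hGinv]
  -- the derivative of `Ginv`
  have hψ' : HasFDerivAt (fun x : EuclideanSpace ℝ (Fin n) × EuclideanSpace ℝ (Fin n) => ψv x.1)
      ((fderiv ℝ ψv Θ).comp (ContinuousLinearMap.fst ℝ _ _)) (Θ, R) :=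
    HasFDerivAt.comp (Θ, R) (g := ψv) (hψd Θ).hasFDerivAt hasFDerivAt_fst
  have hB := (HasFDerivAt.comp (Θ, R) (g := fderiv ℝ φv) (hφ.hasFDerivAt_fderiv θ) hψ').star
  have hS' := HasFDerivAt.comp (Θ, R) (g := gradient S) (hS.hasFDerivAt_fderiv θ).gradient hψ'
  obtain ⟨D, hD, hD₁, hD₂⟩ : ∃ D, HasFDerivAt Ginv D (Θ, R) ∧
      (∀ k, (D k).1 = fderiv ℝ ψv Θ k.1) ∧
      ∀ k u, ⟪(D k).2, u⟫ =
        ⟪R, fderiv ℝ (fderiv ℝ φv) θ (fderiv ℝ ψv Θ k.1) u⟫ + ⟪k.2, fderiv ℝ φv θ u⟫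
          - fderiv ℝ (fderiv ℝ S) θ (fderiv ℝ ψv Θ k.1) u := by
    have h := hψ'.prodMk (((hB.clm_apply hasFDerivAt_snd).sub hS').sub_const ξ)
    refine ⟨_, h.congr_of_eventuallyEq (.of_eq hGinv), ?_, ?_⟩
    · intro k
      simp
    · intro k u
      simp [inner_sub_left, inner_add_left, inner_rieszSymm, star_eq_adjoint,
        adjoint_inner_left, ← hθ]
      ring
  -- the derivative of `Hhat`
  have hHq := (hHd q).hasFDerivAt
  obtain ⟨L, hL, hLk⟩ : ∃ L, HasFDerivAt Hhat L (Θ, R) ∧ ∀ k, L k = fderiv ℝ H q (D k)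
      - η * (fderiv ℝ S θ (fderiv ℝ ψv Θ k.1) + ⟪ζ + ξ, fderiv ℝ ψv Θ k.1 - k.1⟫) := by
    have h := (HasFDerivAt.comp (Θ, R) (g := H) hHq hD).sub
      (((HasFDerivAt.comp (Θ, R) (g := S) (hSd θ).hasFDerivAt hψ').add
        ((hasFDerivAt_const (ζ + ξ) _).inner ℝ (hψ'.sub hasFDerivAt_fst))).const_mul η)
    refine ⟨_, h.congr_of_eventuallyEq (.of_eq hHhat), fun k => ?_⟩
    simp [mul_add]
  set hr := gradient (fun r => H (q.1, r)) q.2 with hhr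
  set ht := gradient (fun t => H (t, q.2)) q.1 with hht
  have hHsplit : ∀ z, fderiv ℝ H q z = ⟪ht, z.1⟫ + ⟪z.2, hr⟫ := fun z => by
    rw [real_inner_comm hr, hht, hhr, inner_gradient_prodMk_left hHq,
      inner_gradient_prodMk_right hHq, ← map_add]
    simp
  -- the momentum gradient of `Hhat`
  have hgR : gradient (fun R => Hhat (Θ, R)) R = fderiv ℝ φv θ hr := by
    refine ext_inner_right ℝ fun k => ?_
    rw [inner_gradient_prodMk_right (p := (Θ, R)) hL, hLk, hHsplit, hD₁, hD₂]
    simp [real_inner_comm]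
  set w : EuclideanSpace ℝ (Fin n) × EuclideanSpace ℝ (Fin n) :=
    (gradient (fun R => Hhat (Θ, R)) R,
      -gradient (fun Θ => Hhat (Θ, R)) Θ - η • (R - (ζ + ξ))) with hw
  have hw₁ : w.1 = fderiv ℝ φv θ hr := hgR
  have hDw : D w = V q := by
    rw [hV]
    refine Prod.ext ?_ (ext_inner_right ℝ fun u => ?_)
    · rw [hD₁, hw₁, hψφ]
    · have hgΘ := inner_gradient_prodMk_left (p := (Θ, R)) hL (fderiv ℝ φv θ u)
      rw [hLk, hHsplit, hD₁, hD₂] at hgΘ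
      rw [hD₂, hw₁, hψφ]
      have hw₂ : w.2 = -gradient (fun Θ => Hhat (Θ, R)) Θ - η • (R - (ζ + ξ)) := rfl
      have hq₂ : q.2 = adjoint (fderiv ℝ φv θ) R - gradient S θ - ξ := by rw [hq_eq]
      change _ = ⟪-ht - η • (q.2 - ζ), u⟫
      simp only [hψφ, inner_zero_left] at hgΘ
      rw [hw₂, hq₂, hφ.fderiv_fderiv_comm θ hr u, hS.fderiv_fderiv_comm θ hr u]
      simp only [inner_sub_left, inner_neg_left, inner_add_left, inner_sub_right,
        real_inner_smul_left, adjoint_inner_left, inner_gradient_eq_fderiv S] at hgΘ ⊢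
      rw [hgΘ]
      ring
  -- `G` is a differentiable left inverse of `Ginv`
  have hGd : DifferentiableAt ℝ G q := by
    have hA : A = fun x => star (fderiv ℝ ψv (φv x)) :=
      funext fun x => eq_adjoint_fderiv_inverse hφd hψd hlr (hA₁ x)
    have hfd : DifferentiableAt ℝ
        (fun x : EuclideanSpace ℝ (Fin n) × EuclideanSpace ℝ (Fin n) => φv x.1) q :=
      (hφd q.1).comp q differentiableAt_fst
    have hgd : DifferentiableAt ℝ
        (fun x : EuclideanSpace ℝ (Fin n) × EuclideanSpace ℝ (Fin n) => gradient S x.1) q :=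
      (hS.hasFDerivAt_fderiv q.1).gradient.differentiableAt.comp q differentiableAt_fst
    have hAd : DifferentiableAt ℝ
        (fun x : EuclideanSpace ℝ (Fin n) × EuclideanSpace ℝ (Fin n) =>
          star (fderiv ℝ ψv (φv x.1))) q :=
      (DifferentiableAt.comp q (g := fderiv ℝ ψv)
        (hψ.hasFDerivAt_fderiv (φv q.1)).differentiableAt hfd).star
    rw [hG, hA]
    exact hfd.prodMk (hAd.clm_apply ((differentiableAt_snd.add hgd).add_const ξ))
  have hGG : G ∘ Ginv = id := by
    funext x
    rw [hG, hGinv]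
    refine Prod.ext (hrl x.1) ?_
    refine (congrArg (A (ψv x.1)) ?_).trans (DFunLike.congr_fun (hA₁ (ψv x.1)) x.2)
    dsimp only
    abel
  have hcomp : (fderiv ℝ G q).comp D = ContinuousLinearMap.id ℝ _ := by
    have h := HasFDerivAt.comp (Θ, R) (g := G) hGd.hasFDerivAt hD
    rw [hGG] at h
    exact h.unique (hasFDerivAt_id _)
  rw [← hDw]
  exact DFunLike.congr_fun hcomp w
end

section
/- Weighted-norm estimate for the directional-derivative convolution term in the Lie bracket (from Lemma C.1). Let n ≥ 1, s > 0, σ > 0, and let f = (f_k)_{k∈ℤⁿ} and g = (g_k)_{k∈ℤⁿ} be families of vectors of ℂⁿ with |f|_{s+σ} < ∞ and |g|_{s+σ} < ∞, where |f|_t = Σ_k ‖f_k‖_∞ e^{|k|t}. Define for each ℓ ∈ ℤⁿ the vector h_ℓ = Σ_{k∈ℤⁿ} i·(k·f_{ℓ−k})·g_k ∈ ℂⁿ (the ℓ-th Fourier coefficient of the term Dg·f of the Lie bracket of the torus vector fields with coefficients f and g; here k·w = k₁w₁+⋯+kₙwₙ). Then the series defining each h_ℓ converges absolutely and Σ_{ℓ∈ℤⁿ}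 ‖h_ℓ‖_∞ · e^{|ℓ|s} ≤ (1/(eσ)) · |f|_{s+σ} · |g|_{s+σ}. -/
open scoped BigOperators ENNReal

/-- The ℓ¹-norm `|k| = |k₁| + ⋯ + |kₙ|` of a multi-integer `k ∈ ℤⁿ`. -/
noncomputable def knorm {n : ℕ} (k : Fin n → ℤ) : ℝ := ∑ j, |(k j : ℝ)|

/-- The weighted norm `|f|_t = Σ_k ‖f_k‖_∞ e^{|k|t} ∈ [0,∞]` of a family of vectors of
`ℂⁿ` (the norm on `Fin n → ℂ` is the sup norm `‖·‖_∞`). -/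
noncomputable def fwnorm {n : ℕ} (t : ℝ) (f : (Fin n → ℤ) → Fin n → ℂ) : ℝ≥0∞ :=
  ∑' k : Fin n → ℤ, (‖f k‖₊ : ℝ≥0∞) * ENNReal.ofReal (Real.exp (knorm k * t))

theorem knorm_nonneg {n : ℕ} (k : Fin n → ℤ) : 0 ≤ knorm k :=
  Finset.sum_nonneg fun _ _ => abs_nonneg _

theorem knorm_add_le {n : ℕ} (k l : Fin n → ℤ) : knorm (k + l) ≤ knorm k + knorm l := by
  simp only [knorm, ← Finset.sum_add_distrib, Pi.add_apply, Int.cast_add]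
  exact Finset.sum_le_sum fun _ _ => abs_add_le _ _

theorem le_inv_exp_one_mul_exp {σ : ℝ} (hσ : 0 < σ) (x : ℝ) :
    x ≤ 1 / (Real.exp 1 * σ) * Real.exp (x * σ) := by
  have h := Real.add_one_le_exp (x * σ - 1)
  rw [Real.exp_sub, sub_add_cancel, le_div_iff₀ (Real.exp_pos 1)] at h
  rw [div_mul_eq_mul_div, one_mul, le_div_iff₀ (by positivity)]
  linarith

theorem norm_dot_le_knorm_mul_norm {n : ℕ} (k : Fin n → ℤ) (w : Fin n → ℂ) :
    ‖∑ j, (k j : ℂ) * w j‖ ≤ knorm k * ‖w‖ := by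
  rw [knorm, Finset.sum_mul]
  refine norm_sum_le_of_le _ fun j _ => ?_
  rw [norm_mul, Complex.norm_intCast]
  exact mul_le_mul_of_nonneg_left (norm_le_pi_norm w j) (abs_nonneg _)

theorem norm_dot_smul_mul_exp_le {n : ℕ} {s σ : ℝ} (hs : 0 ≤ s) (hσ : 0 < σ)
    (k m : Fin n → ℤ) (v w : Fin n → ℂ) :
    ‖(Complex.I * ∑ j, (k j : ℂ) * v j) • w‖ * Real.exp (knorm (m + k) * s) ≤
      1 / (Real.exp 1 * σ) * ((‖v‖ * Real.exp (knorm m * (s + σ))) *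
        (‖w‖ * Real.exp (knorm k * (s + σ)))) := by
  have hk := knorm_nonneg k
  have hm := knorm_nonneg m
  rw [norm_smul, norm_mul, Complex.norm_I, one_mul]
  calc
    _ ≤ knorm k * ‖v‖ * ‖w‖ * (Real.exp (knorm m * (s + σ)) * Real.exp (knorm k * s)) := by
        gcongr
        · exact norm_dot_le_knorm_mul_norm k v
        · rw [← Real.exp_add]
          gcongr
          nlinarith [mul_le_mul_of_nonneg_right (knorm_add_le m k) hs, mul_nonneg hm hσ.le]
    _ ≤ (1 / (Real.exp 1 * σ) * Real.exp (knorm k * σ)) * ‖v‖ * ‖w‖ *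
          (Real.exp (knorm m * (s + σ)) * Real.exp (knorm k * s)) := by
        gcongr
        exact le_inv_exp_one_mul_exp hσ _
    _ = _ := by
        rw [mul_add (knorm k), Real.exp_add (knorm k * s)]
        ring

theorem ENNReal.tsum_tsum_sub_mul {G : Type*} [AddGroup G] (F H : G → ℝ≥0∞) :
    ∑' l, ∑' k, F (l - k) * H k = (∑' k, F k) * ∑' k, H k := by
  rw [ENNReal.tsum_comm, ← ENNReal.tsum_mul_left]
  refine tsum_congr fun k => ?_
  rw [ENNReal.tsum_mul_right, ← (Equiv.subRight k).tsum_eq F]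
  rfl

theorem tsum_tsum_enorm_dot_smul_mul_exp_le {n : ℕ} {s σ : ℝ} (hs : 0 ≤ s) (hσ : 0 < σ)
    (f g : (Fin n → ℤ) → Fin n → ℂ) :
    ∑' l : Fin n → ℤ, (∑' k : Fin n → ℤ,
        ‖(Complex.I * ∑ j, (k j : ℂ) * f (l - k) j) • g k‖ₑ) *
          ENNReal.ofReal (Real.exp (knorm l * s))
      ≤ ENNReal.ofReal (1 / (Real.exp 1 * σ)) * (fwnorm (s + σ) f * fwnorm (s + σ) g) := by
  simp only [fwnorm]
  rw [← ENNReal.tsum_tsum_sub_mul, ← ENNReal.tsum_mul_left]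
  refine ENNReal.tsum_le_tsum fun l => ?_
  rw [← ENNReal.tsum_mul_right, ← ENNReal.tsum_mul_left]
  refine ENNReal.tsum_le_tsum fun k => ?_
  have h := ENNReal.ofReal_le_ofReal
    (norm_dot_smul_mul_exp_le hs hσ k (l - k) (f (l - k)) (g k))
  rw [sub_add_cancel, ENNReal.ofReal_mul (norm_nonneg _), ENNReal.ofReal_mul (by positivity),
    ENNReal.ofReal_mul (by positivity), ENNReal.ofReal_mul (norm_nonneg _),
    ENNReal.ofReal_mul (norm_nonneg _)] at h
  simpa only [ofReal_norm, enorm_eq_nnnorm] using h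


/-- **Weighted-norm estimate for the directional-derivative convolution term of the Lie
bracket** (from Lemma C.1).  With `h_ℓ = Σ_k i (k·f_{ℓ−k}) g_k`, the series converges
absolutely for each `ℓ` and `Σ_ℓ ‖h_ℓ‖_∞ e^{|ℓ|s} ≤ (1/(eσ)) |f|_{s+σ} |g|_{s+σ}`. -/
theorem lie_bracket_convolution_estimate (n : ℕ) (hn : 1 ≤ n) (s σ : ℝ)
    (hs : 0 < s) (hσ : 0 < σ) (f g : (Fin n → ℤ) → Fin n → ℂ)
    (hf : fwnorm (s + σ) f < ⊤) (hg : fwnorm (s + σ) g < ⊤) :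
    (∀ ℓ : Fin n → ℤ, Summable fun k : Fin n → ℤ =>
        ‖(Complex.I * ∑ j, (k j : ℂ) * f (ℓ - k) j) • g k‖) ∧
    ∑' ℓ : Fin n → ℤ,
        (‖∑' k : Fin n → ℤ, (Complex.I * ∑ j, (k j : ℂ) * f (ℓ - k) j) • g k‖₊ : ℝ≥0∞) *
          ENNReal.ofReal (Real.exp (knorm ℓ * s))
      ≤ ENNReal.ofReal (1 / (Real.exp 1 * σ)) * (fwnorm (s + σ) f * fwnorm (s + σ) g) := by
  have hle := tsum_tsum_enorm_dot_smul_mul_exp_le hs.le hσ f g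
  have hsum : ∀ ℓ : Fin n → ℤ, Summable fun k : Fin n → ℤ =>
      ‖(Complex.I * ∑ j, (k j : ℂ) * f (ℓ - k) j) • g k‖ := fun ℓ => by
    have hlt := (ENNReal.le_tsum ℓ).trans_lt (hle.trans_lt
      (ENNReal.mul_lt_top ENNReal.ofReal_lt_top (ENNReal.mul_lt_top hf hg)))
    have hone : 1 ≤ ENNReal.ofReal (Real.exp (knorm ℓ * s)) :=
      ENNReal.one_le_ofReal.2 (Real.one_le_exp (mul_nonneg (knorm_nonneg ℓ) hs.le))
    have hfin := (le_mul_of_one_le_right' hone).trans_lt hlt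
    have := ENNReal.tsum_coe_ne_top_iff_summable.1 hfin.ne
    exact NNReal.summable_coe.2 this
  refine ⟨hsum, (ENNReal.tsum_le_tsum fun ℓ => ?_).trans hle⟩
  gcongr
  exact enorm_tsum_le_tsum_enorm
end
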